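/- arXiv:1510.01525 — 2 statements merged into one kernel-verified Lean document; each statement's English description precedes it below -/
import Mathlib

section
/- Let λ > 1, c₁ > 0, C > 0 be constants, let n ≥ 2 be an integer, let ε̃ > 0, and let 𝒞 : [0,∞) → [0,∞) be a bounded function. Suppose F : (0,∞) → [0,∞) is a function for which there exists s₀ > 0 such that F(s) ≤ exp( −(1/s)·( log( e + 1/s ) )^{−λ} ) for all s ∈ (0, s₀]. Then there exists a₀ > e such that for every a ≥ a₀ and every t ≥ a·(log a)^{1+ε̃} one has F( a/(c₁ t) ) · ( log(1+a) + 𝒞(a) ) · t^{C(n−1)} ≤ a^{−2}. -/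
open Filter Asymptotics in
/-- Powers `x ^ p` with `p < 1` and logarithms are eventually dominated by
`x (log (e + x)) ^ (-r)`. -/
theorem eventually_rpow_add_log_le_mul_log_rpow_neg {A K p : ℝ} (B r : ℝ)
    (hA : 0 ≤ A) (hK : 0 ≤ K) (hp₀ : 0 ≤ p) (hp₁ : p < 1) :
    ∀ᶠ x : ℝ in atTop,
      A * x ^ p + K * Real.log x + B ≤ x * Real.log (Real.exp 1 + x) ^ (-r) := by
  have h₁ : (fun y : ℝ => y ^ p * Real.log y ^ r) =o[atTop] (fun y : ℝ => y) := by
    refine ((isBigO_refl (fun y : ℝ => y ^ p) atTop).mul_isLittleO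
      (isLittleO_log_rpow_rpow_atTop r (sub_pos.2 hp₁))).congr' .rfl ?_
    filter_upwards [eventually_gt_atTop 0] with y hy
    rw [← Real.rpow_add hy, add_sub_cancel, Real.rpow_one]
  have h₂ : (fun y : ℝ => Real.log y * Real.log y ^ r) =o[atTop] (fun y : ℝ => y) := by
    refine (isLittleO_log_rpow_rpow_atTop (1 + r) one_pos).congr' ?_ ?_
    · filter_upwards [eventually_gt_atTop 1] with y hy
      rw [Real.rpow_add (Real.log_pos hy), Real.rpow_one]
    · exact .of_forall fun y => Real.rpow_one y
  have h₃ : (fun y : ℝ => Real.log y ^ r) =o[atTop] (fun y : ℝ => y) :=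
    (isLittleO_log_rpow_rpow_atTop r one_pos).congr_right Real.rpow_one
  have h := ((h₁.const_mul_left A).add (h₂.const_mul_left K)).add (h₃.const_mul_left B)
  have hy : Tendsto (fun x : ℝ => Real.exp 1 + x) atTop atTop :=
    tendsto_atTop_add_const_left _ _ tendsto_id
  filter_upwards [hy.eventually (h.bound one_half_pos), eventually_ge_atTop (Real.exp 1)]
    with x hx hxe
  have he := Real.exp_pos 1
  have hx₀ : 0 < x := he.trans_le hxe
  have hlog : 0 < Real.log (Real.exp 1 + x) :=
    Real.log_pos (by linarith [Real.add_one_le_exp 1])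
  have hpow := Real.rpow_pos_of_pos hlog r
  rw [Real.norm_of_nonneg (by positivity : 0 ≤ Real.exp 1 + x)] at hx
  rw [Real.rpow_neg hlog.le, ← div_eq_mul_inv, le_div_iff₀ hpow]
  have hle : A * x ^ p + K * Real.log x + B ≤
      A * (Real.exp 1 + x) ^ p + K * Real.log (Real.exp 1 + x) + B := by
    gcongr <;> linarith
  have hbound := (le_abs_self _).trans hx
  have := mul_le_mul_of_nonneg_right hle hpow.le
  linarith

/-- If `F` satisfies `F(s) ≤ exp(-(1/s)(log(e + 1/s))^(-λ))` for all small
`s > 0`, then for all sufficiently large `a` and all `t ≥ a (log a)^(1+ε̃)` one has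
`F(a/(c₁ t)) (log(1+a) + 𝒞(a)) t^(C(n-1)) ≤ a^(-2)`. -/
theorem F_decay_dominates (lam c₁ C ε' : ℝ) (n : ℕ)
    (hlam : 1 < lam) (hc₁ : 0 < c₁) (hC : 0 < C) (hn : 2 ≤ n) (hε' : 0 < ε')
    (𝒞 : ℝ → ℝ) (h𝒞nonneg : ∀ x, 0 ≤ x → 0 ≤ 𝒞 x)
    (h𝒞bdd : ∃ M : ℝ, ∀ x, 0 ≤ x → 𝒞 x ≤ M)
    (F : ℝ → ℝ) (hFnonneg : ∀ s, 0 < s → 0 ≤ F s)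
    (hF : ∃ s₀ : ℝ, 0 < s₀ ∧ ∀ s, 0 < s → s ≤ s₀ →
      F s ≤ Real.exp (-(1 / s) * Real.log (Real.exp 1 + 1 / s) ^ (-lam))) :
    ∃ a₀ : ℝ, Real.exp 1 < a₀ ∧ ∀ a, a₀ ≤ a →
      ∀ t, a * Real.log a ^ (1 + ε') ≤ t →
        F (a / (c₁ * t)) * (Real.log (1 + a) + 𝒞 a) * t ^ (C * ((n : ℝ) - 1))
          ≤ a ^ (-2 : ℝ) := by
  have hn' : (0 : ℝ) ≤ (n : ℝ) - 1 := by
    have : (2 : ℝ) ≤ n := by exact_mod_cast hn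
    linarith
  set K : ℝ := C * ((n : ℝ) - 1)
  have hK : 0 ≤ K := mul_nonneg hC.le hn'
  obtain ⟨M, hM⟩ := h𝒞bdd
  obtain ⟨s₀, hs₀, hFs⟩ := hF
  set p : ℝ := (1 + ε')⁻¹ with hp
  have hp₀ : 0 < p := by positivity
  have hp₁ : p < 1 := inv_lt_one_of_one_lt₀ (by linarith)
  obtain ⟨X, hX⟩ := Filter.eventually_atTop.1
    (eventually_rpow_add_log_le_mul_log_rpow_neg (A := (3 + K) * (c₁⁻¹) ^ p)
      (-(K * Real.log c₁)) lam (by positivity) hK hp₀.le hp₁)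
  have hlarge : Filter.Tendsto (fun a : ℝ => c₁ * Real.log a ^ (1 + ε'))
      Filter.atTop Filter.atTop :=
    ((tendsto_rpow_atTop (by linarith)).comp Real.tendsto_log_atTop).const_mul_atTop hc₁
  have hlog : ∀ᶠ a : ℝ in Filter.atTop, Real.log (1 + a) + M ≤ a := by
    have hy : Filter.Tendsto (fun a : ℝ => 1 + a) Filter.atTop Filter.atTop :=
      Filter.tendsto_atTop_add_const_left _ _ Filter.tendsto_id
    filter_upwards [hy.eventually (Real.isLittleO_log_id_atTop.bound one_half_pos),
      Filter.eventually_ge_atTop (2 * M + 1), Filter.eventually_ge_atTop 0] with a ha haM ha₀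
    have := (le_abs_self _).trans ha
    rw [id, Real.norm_of_nonneg (by linarith)] at this
    linarith
  obtain ⟨a₁, ha₁⟩ := Filter.eventually_atTop.1
    ((hlarge.eventually_ge_atTop (max X s₀⁻¹)).and hlog)
  refine ⟨max a₁ (Real.exp 1 + 1), lt_max_of_lt_right (by linarith), fun a ha t ht => ?_⟩
  obtain ⟨hax, hal⟩ := ha₁ a (le_of_max_le_left ha)
  have hae : Real.exp 1 + 1 ≤ a := le_of_max_le_right ha
  have ha1 : 1 < a := by linarith [Real.exp_pos 1]
  have ha₀ : 0 < a := by linarith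
  have hL : 0 < Real.log a := Real.log_pos ha1
  have ht₀ : 0 < t := lt_of_lt_of_le (by positivity) ht
  set x : ℝ := c₁ * t / a with hx
  have hx₀ : 0 < x := by positivity
  have hLx : Real.log a ^ (1 + ε') ≤ c₁⁻¹ * x := by
    have : c₁⁻¹ * x = t / a := by rw [hx]; field_simp
    rw [this, le_div_iff₀ ha₀, mul_comm]
    exact ht
  have hxlarge : max X s₀⁻¹ ≤ x := by
    refine hax.trans ?_
    have := mul_le_mul_of_nonneg_left hLx hc₁.le
    rwa [mul_inv_cancel_left₀ hc₁.ne'] at this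
  have hLp : Real.log a ≤ c₁⁻¹ ^ p * x ^ p := by
    rw [← Real.mul_rpow (by positivity) hx₀.le]
    calc Real.log a = (Real.log a ^ (1 + ε')) ^ p := by
          rw [hp, Real.rpow_rpow_inv hL.le (by positivity)]
      _ ≤ _ := by gcongr
  have hlogt : Real.log t = Real.log x + Real.log a - Real.log c₁ := by
    rw [hx, Real.log_div (by positivity) ha₀.ne', Real.log_mul hc₁.ne' ht₀.ne']
    ring
  have hs : 1 / (a / (c₁ * t)) = x := by rw [one_div_div]
  have hFx : F (a / (c₁ * t)) ≤
      Real.exp (-(x * Real.log (Real.exp 1 + x) ^ (-lam))) := by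
    have h := hFs (a / (c₁ * t)) (by positivity) (by
      rw [← one_div_one_div (a / (c₁ * t)), hs, one_div]
      exact inv_le_of_inv_le₀ hs₀ (le_of_max_le_right hxlarge))
    rwa [hs, neg_mul] at h
  have hdom := hX x (le_of_max_le_left hxlarge)
  have hsum : Real.log (1 + a) + 𝒞 a ≤ Real.exp (Real.log a) := by
    rw [Real.exp_log ha₀]
    linarith [hM a ha₀.le]
  have hsum₀ : 0 ≤ Real.log (1 + a) + 𝒞 a :=
    add_nonneg (Real.log_nonneg (by linarith)) (h𝒞nonneg a ha₀.le)
  calc F (a / (c₁ * t)) * (Real.log (1 + a) + 𝒞 a) * t ^ K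
      ≤ Real.exp (-(x * Real.log (Real.exp 1 + x) ^ (-lam))) * Real.exp (Real.log a) *
          Real.exp (Real.log t * K) := by
        rw [Real.rpow_def_of_pos ht₀]
        gcongr
    _ ≤ Real.exp (Real.log a * (-2)) := by
        rw [← Real.exp_add, ← Real.exp_add, Real.exp_le_exp, hlogt]
        have := mul_le_mul_of_nonneg_left hLp (by positivity : 0 ≤ 3 + K)
        linarith
    _ = a ^ (-2 : ℝ) := (Real.rpow_def_of_pos ha₀ _).symm
end

section
/- Fix p > 1 and ε₀ ∈ (0,1). Then there exist functions G : [0,∞) → [0,∞) and F : [0,∞) → [0,∞) with the following properties: (i) G is a Young function, i.e., G(t) = ∫₀ᵗ g(s) ds for some homeomorphism g : [0,∞) → [0,∞); (ii) G is a homeomorphism of [0,∞) onto itself and a diffeomorphism on (0,∞); (iii) ∫₀¹ dt / G⁻¹(t) < ∞; (iv) lim_{t→0⁺} t·G'(t)/G(t) = 1; (v) the functions t ↦ G(t^{1/p})^p and t ↦ F(t^{1/p}) form a complementary Young pair, i.e., there exists a homeomorphism φ : [0,∞) → [0,∞) such that G(t^{1/p})^p = ∫₀ᵗ φ(s) ds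 and F(t^{1/p}) = ∫₀ᵗ φ⁻¹(s) ds for all t ≥ 0; and (vi) F(t) ≤ t^{p+ε₀} · exp( −(1/t)·( log( e + 1/t ) )^{−1−ε₀} ) for all t > 0. -/
/-- A homeomorphism of `[0,∞)` onto itself: a continuous, strictly increasing bijection of
`[0,∞)` onto `[0,∞)` fixing `0`. -/
def IsIciHomeo (φ : ℝ → ℝ) : Prop :=
  φ 0 = 0 ∧ ContinuousOn φ (Set.Ici 0) ∧ StrictMonoOn φ (Set.Ici 0) ∧
    Set.MapsTo φ (Set.Ici 0) (Set.Ici 0) ∧ Set.SurjOn φ (Set.Ici 0) (Set.Ici 0)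

open Set Filter Topology MeasureTheory

namespace IsIciHomeo

lemma nonneg {f : ℝ → ℝ} (hf : IsIciHomeo f) {x : ℝ} (hx : 0 ≤ x) : 0 ≤ f x :=
  hf.2.2.2.1 hx

lemma pos {f : ℝ → ℝ} (hf : IsIciHomeo f) {x : ℝ} (hx : 0 < x) : 0 < f x := by
  simpa [hf.1] using hf.2.2.1 (mem_Ici.2 le_rfl) (mem_Ici.2 hx.le) hx

lemma mono {f : ℝ → ℝ} (hf : IsIciHomeo f) {x y : ℝ} (hx : 0 ≤ x) (hxy : x ≤ y) : f x ≤ f y :=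
  hf.2.2.1.monotoneOn hx (hx.trans hxy) hxy

lemma of_tendsto {f : ℝ → ℝ} (h0 : f 0 = 0) (hc : ContinuousOn f (Ici 0))
    (hm : StrictMonoOn f (Ici 0)) (ht : Tendsto f atTop atTop) : IsIciHomeo f := by
  refine ⟨h0, hc, hm, fun x hx => ?_, fun y hy => ?_⟩
  · simpa [h0] using hm.monotoneOn (mem_Ici.2 le_rfl) hx hx
  · obtain ⟨b, hb0, hb⟩ := ((eventually_ge_atTop 0).and (ht.eventually_ge_atTop y)).exists
    obtain ⟨x, hx, hxy⟩ := intermediate_value_Icc hb0 (hc.mono Icc_subset_Ici_self)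
      ⟨h0.le.trans hy, hb⟩
    exact ⟨x, hx.1, hxy⟩

lemma tendsto_atTop {f : ℝ → ℝ} (hf : IsIciHomeo f) : Tendsto f atTop atTop := by
  refine Filter.tendsto_atTop.2 fun b => ?_
  obtain ⟨x, hx, hxb⟩ := hf.2.2.2.2 (mem_Ici.2 (le_max_right b 0))
  filter_upwards [eventually_ge_atTop x] with y hy
  exact (le_max_left b 0).trans (hxb ▸ hf.mono hx hy)

lemma comp {f g : ℝ → ℝ} (hf : IsIciHomeo f) (hg : IsIciHomeo g) :
    IsIciHomeo (fun x => f (g x)) :=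
  of_tendsto (by simp [hf.1, hg.1]) (hf.2.1.comp hg.2.1 hg.2.2.2.1)
    (fun _ hx _ hy hxy => hf.2.2.1 (hg.nonneg hx) (hg.nonneg hy) (hg.2.2.1 hx hy hxy))
    (hf.tendsto_atTop.comp hg.tendsto_atTop)

lemma rpow {q : ℝ} (hq : 0 < q) : IsIciHomeo (fun x => x ^ q) :=
  of_tendsto (Real.zero_rpow hq.ne') (Real.continuous_rpow_const hq.le).continuousOn
    (Real.strictMonoOn_rpow_Ici_of_exponent_pos hq) (tendsto_rpow_atTop hq)

lemma const_mul {c : ℝ} (hc : 0 < c) : IsIciHomeo (fun x => c * x) :=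
  of_tendsto (mul_zero c) (by fun_prop) (fun _ _ _ _ h => mul_lt_mul_of_pos_left h hc)
    (tendsto_id.const_mul_atTop hc)

lemma tendsto_nhdsGT {f : ℝ → ℝ} (hf : IsIciHomeo f) : Tendsto f (𝓝[>] 0) (𝓝[>] 0) := by
  refine tendsto_nhdsWithin_iff.2 ⟨?_, ?_⟩
  · have h := (hf.2.1 0 (mem_Ici.2 le_rfl)).tendsto
    rw [hf.1] at h
    exact h.mono_left (nhdsWithin_mono _ Ioi_subset_Ici_self)
  · filter_upwards [self_mem_nhdsWithin] with x hx
    exact hf.pos hx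

lemma exists_inverse {f : ℝ → ℝ} (hf : IsIciHomeo f) :
    ∃ g : ℝ → ℝ, IsIciHomeo g ∧ Continuous g ∧ ∀ x, 0 ≤ x → g (f x) = x ∧ f (g x) = x := by
  let F : Ici (0 : ℝ) → Ici (0 : ℝ) := fun x => ⟨f x, hf.2.2.2.1 x.2⟩
  have hF : StrictMono F := fun x y hxy => hf.2.2.1 x.2 y.2 hxy
  have hs : Function.Surjective F := fun y => by
    obtain ⟨x, hx, hxy⟩ := hf.2.2.2.2 y.2
    exact ⟨⟨x, hx⟩, Subtype.ext hxy⟩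
  let e := hF.orderIsoOfSurjective F hs
  have he : ∀ x, e x = F x := fun x => rfl
  let g : ℝ → ℝ := fun x => e.symm (projIci 0 x)
  have hgc : Continuous g :=
    continuous_subtype_val.comp (e.symm.continuous.comp
      (Continuous.subtype_mk (continuous_const.max continuous_id) _))
  have hproj : ∀ (x : ℝ) (hx : 0 ≤ x), projIci 0 x = ⟨x, hx⟩ := fun x hx =>
    Subtype.ext (max_eq_right hx)
  have hgf : ∀ x, 0 ≤ x → g (f x) = x := fun x hx => by
    have h1 : projIci 0 (f x) = e ⟨x, hx⟩ := hproj _ (hf.nonneg hx)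
    simp only [g, h1, e.symm_apply_apply]
  have hfg : ∀ x, 0 ≤ x → f (g x) = x := fun x hx => by
    have h1 : e (e.symm (projIci 0 x)) = projIci 0 x := e.apply_symm_apply _
    rw [he, hproj x hx] at h1
    simpa [F, g, hproj x hx] using congrArg Subtype.val h1
  have hg0 : ∀ x, 0 ≤ g x := fun x => (e.symm (projIci 0 x)).2
  refine ⟨g, ⟨?_, hgc.continuousOn, ?_, fun x _ => hg0 x,
    fun x hx => ⟨f x, hf.nonneg hx, hgf x hx⟩⟩,
    hgc, fun x hx => ⟨hgf x hx, hfg x hx⟩⟩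
  · simpa [hf.1] using hgf 0 le_rfl
  · intro x hx y hy hxy
    refine (hf.2.2.1.lt_iff_lt (hg0 x) (hg0 y)).1 ?_
    rwa [hfg x hx, hfg y hy]

end IsIciHomeo

lemma hasDerivAt_integral_of_continuous {g : ℝ → ℝ} (hg : Continuous g) (t : ℝ) :
    HasDerivAt (fun t => ∫ s in (0 : ℝ)..t, g s) (g t) t :=
  intervalIntegral.integral_hasDerivAt_right (hg.intervalIntegrable _ _)
    (hg.stronglyMeasurableAtFilter _ _) hg.continuousAt

lemma mul_sub_le_integral {g : ℝ → ℝ} (hg : IsIciHomeo g) (hgc : Continuous g) {a b : ℝ}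
    (ha : 0 ≤ a) (hab : a ≤ b) : (b - a) * g a ≤ ∫ s in a..b, g s := by
  have h := intervalIntegral.integral_mono_on hab (intervalIntegrable_const (μ := volume) (c := g a))
    (hgc.intervalIntegrable a b) (fun x hx => hg.mono ha hx.1)
  simpa using h

lemma integral_le_mul_sub {g : ℝ → ℝ} (hg : IsIciHomeo g) (hgc : Continuous g) {a b : ℝ}
    (ha : 0 ≤ a) (hab : a ≤ b) : ∫ s in a..b, g s ≤ (b - a) * g b := by
  have h := intervalIntegral.integral_mono_on hab (hgc.intervalIntegrable a b)
    (intervalIntegrable_const (μ := volume) (c := g b)) (fun x hx => hg.mono (ha.trans hx.1) hx.2)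
  simpa using h

lemma half_mul_le_integral {g : ℝ → ℝ} (hg : IsIciHomeo g) (hgc : Continuous g) {u : ℝ}
    (hu : 0 ≤ u) : u / 2 * g (u / 2) ≤ ∫ s in (0 : ℝ)..u, g s := by
  have h1 := mul_sub_le_integral hg hgc (a := u / 2) (b := u) (by linarith) (by linarith)
  have h2 := mul_sub_le_integral hg hgc (a := 0) (b := u / 2) le_rfl (by linarith)
  rw [hg.1] at h2
  have h3 := intervalIntegral.integral_add_adjacent_intervals
    (hgc.intervalIntegrable (μ := volume) 0 (u / 2)) (hgc.intervalIntegrable (u / 2) u)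
  linarith

lemma isIciHomeo_integral {g : ℝ → ℝ} (hg : IsIciHomeo g) (hgc : Continuous g) :
    IsIciHomeo (fun t => ∫ s in (0 : ℝ)..t, g s) := by
  have hd := hasDerivAt_integral_of_continuous hgc
  have hc : Continuous (fun t => ∫ s in (0 : ℝ)..t, g s) :=
    continuous_iff_continuousAt.2 fun t => (hd t).continuousAt
  refine .of_tendsto (by simp) hc.continuousOn ?_ ?_
  · refine strictMonoOn_of_deriv_pos (convex_Ici 0) hc.continuousOn fun x hx => ?_
    rw [interior_Ici, mem_Ioi] at hx
    rw [(hd x).deriv]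
    exact hg.pos hx
  · have h2 : Tendsto (fun u : ℝ => u / 2) atTop atTop := tendsto_id.atTop_div_const two_pos
    refine tendsto_atTop_mono' _ ?_ (h2.atTop_mul_atTop₀ (hg.tendsto_atTop.comp h2))
    filter_upwards [eventually_ge_atTop 0] with u hu
    exact half_mul_le_integral hg hgc hu

/-- The average of an increasing function over `[0,u]` increases with `u`. -/
lemma integral_div_mono {g : ℝ → ℝ} (hg : IsIciHomeo g) (hgc : Continuous g) {u v : ℝ}
    (hu : 0 < u) (huv : u ≤ v) :
    (∫ s in (0 : ℝ)..u, g s) / u ≤ (∫ s in (0 : ℝ)..v, g s) / v := by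
  have h1 := mul_sub_le_integral hg hgc hu.le huv
  have h2 := integral_le_mul_sub hg hgc le_rfl hu.le
  have h3 := intervalIntegral.integral_add_adjacent_intervals
    (hgc.intervalIntegrable (μ := volume) 0 u) (hgc.intervalIntegrable u v)
  rw [div_le_div_iff₀ hu (hu.trans_le huv), ← h3]
  nlinarith

/-- The density of `t ↦ G(t^{1/p})^p` with respect to `t`, in the variable `u = t^{1/p}`, where `G`
is the primitive of `g`. -/
noncomputable def powDensity (p : ℝ) (g : ℝ → ℝ) (u : ℝ) : ℝ :=
  ((∫ s in (0 : ℝ)..u, g s) / u) ^ (p - 1) * g u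

lemma rpow_le_powDensity {p : ℝ} (hp : 1 < p) {g : ℝ → ℝ} (hg : IsIciHomeo g)
    (hgc : Continuous g) {u : ℝ} (hu : 0 < u) : (g (u / 2) / 2) ^ p ≤ powDensity p g u := by
  have h1 : g (u / 2) / 2 ≤ (∫ s in (0 : ℝ)..u, g s) / u := by
    rw [le_div_iff₀ hu]
    linarith [half_mul_le_integral hg hgc hu.le]
  have h2 : 0 < g (u / 2) / 2 := half_pos (hg.pos (half_pos hu))
  have h3 : g (u / 2) / 2 ≤ g u := by
    linarith [hg.mono (half_pos hu).le (half_le_self hu.le)]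
  calc (g (u / 2) / 2) ^ p = (g (u / 2) / 2) ^ (p - 1) * (g (u / 2) / 2) := by
        rw [Real.rpow_sub_one h2.ne', div_mul_cancel₀ _ h2.ne']
    _ ≤ powDensity p g u :=
        mul_le_mul (Real.rpow_le_rpow h2.le h1 (by linarith)) h3 h2.le
          (Real.rpow_nonneg (h2.le.trans h1) _)

lemma isIciHomeo_powDensity {p : ℝ} (hp : 1 < p) {g : ℝ → ℝ} (hg : IsIciHomeo g)
    (hgc : Continuous g) : IsIciHomeo (powDensity p g) := by
  have hG := isIciHomeo_integral hg hgc
  have hd := hasDerivAt_integral_of_continuous hgc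
  have h0 : powDensity p g 0 = 0 := by simp [powDensity, hg.1]
  have hpos : ∀ u, 0 < u → 0 < (∫ s in (0 : ℝ)..u, g s) / u := fun u hu => div_pos (hG.pos hu) hu
  refine .of_tendsto h0 (fun u hu => ?_) (fun u hu v hv huv => ?_) ?_
  · rcases (mem_Ici.1 hu).eq_or_lt with rfl | hu
    · have hb : Tendsto (fun u => g u ^ (p - 1) * g u) (𝓝[Ici 0] 0) (𝓝 0) := by
        have : Continuous (fun u => g u ^ (p - 1) * g u) :=
          (hgc.rpow_const fun _ => .inr (by linarith)).mul hgc
        simpa [hg.1] using this.continuousAt.continuousWithinAt.tendsto (s := Ici 0) (x := 0)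
      rw [ContinuousWithinAt, h0]
      refine squeeze_zero' ?_ ?_ hb
      · filter_upwards [self_mem_nhdsWithin] with u hu
        exact mul_nonneg (Real.rpow_nonneg (div_nonneg (hG.nonneg hu) hu) _) (hg.nonneg hu)
      · filter_upwards [self_mem_nhdsWithin] with u hu
        refine mul_le_mul_of_nonneg_right ?_ (hg.nonneg hu)
        refine Real.rpow_le_rpow (div_nonneg (hG.nonneg hu) hu) ?_ (by linarith)
        refine div_le_of_le_mul₀ hu (hg.nonneg hu) ?_
        linarith [integral_le_mul_sub hg hgc le_rfl hu]
    · exact (((((hd u).continuousAt).div continuousAt_id hu.ne').rpow_const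
        (.inl (hpos u hu).ne')).mul hgc.continuousAt).continuousWithinAt
  · rcases (mem_Ici.1 hu).eq_or_lt with rfl | hu
    · rw [h0]
      exact mul_pos (Real.rpow_pos_of_pos (hpos v huv) _) (hg.pos huv)
    · exact mul_lt_mul' (Real.rpow_le_rpow (hpos u hu).le (integral_div_mono hg hgc hu huv.le)
        (by linarith)) (hg.2.2.1 hu.le hv huv) (hg.pos hu).le
        (Real.rpow_pos_of_pos (hpos v (hu.trans huv)) _)
  · have h2 : Tendsto (fun u : ℝ => (g (u / 2) / 2) ^ p) atTop atTop :=
      (tendsto_rpow_atTop (by linarith)).comp ((hg.tendsto_atTop.comp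
        (tendsto_id.atTop_div_const two_pos)).atTop_div_const two_pos)
    refine tendsto_atTop_mono' _ ?_ h2
    filter_upwards [eventually_gt_atTop 0] with u hu
    exact rpow_le_powDensity hp hg hgc hu

lemma rpow_integral_eq_integral_powDensity {p : ℝ} (hp : 1 < p) {g : ℝ → ℝ} (hg : IsIciHomeo g)
    (hgc : Continuous g) {t : ℝ} (ht : 0 ≤ t) :
    (∫ s in (0 : ℝ)..t ^ (1 / p), g s) ^ p = ∫ s in (0 : ℝ)..t, powDensity p g (s ^ (1 / p)) := by
  have hp0 : 0 < p := by linarith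
  have hG := isIciHomeo_integral hg hgc
  have hr : IsIciHomeo (fun t : ℝ => t ^ (1 / p)) := .rpow (by positivity)
  have hA := (IsIciHomeo.rpow hp0).comp (hG.comp hr)
  have hφ := (isIciHomeo_powDensity hp hg hgc).comp hr
  have h := intervalIntegral.integral_eq_sub_of_hasDerivAt_of_le ht
    (hA.2.1.mono Icc_subset_Ici_self) (f' := fun s => powDensity p g (s ^ (1 / p)))
    (fun x hx => ?_)
    (hφ.2.1.mono (by rw [uIcc_of_le ht]; exact Icc_subset_Ici_self)).intervalIntegrable
  · rw [h, Real.zero_rpow (by positivity : (1 / p) ≠ 0)]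
    simp [Real.zero_rpow hp0.ne']
  · have hx0 : 0 < x := hx.1
    have hu : 0 < x ^ (1 / p) := Real.rpow_pos_of_pos hx0 _
    have hGu := hG.pos hu
    have h1 : HasDerivAt (fun t : ℝ => t ^ (1 / p)) (1 / p * x ^ (1 / p - 1)) x :=
      Real.hasDerivAt_rpow_const (.inl hx0.ne')
    have h2 := ((hasDerivAt_integral_of_continuous hgc _).comp x h1).rpow_const (p := p)
      (.inl hGu.ne')
    refine h2.congr_deriv ?_
    have h3 : x ^ (1 / p - 1) = ((x ^ (1 / p)) ^ (p - 1))⁻¹ := by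
      rw [← Real.rpow_mul hx0.le, ← Real.rpow_neg hx0.le]
      congr 1
      field_simp
      ring
    simp only [powDensity, Function.comp_apply]
    rw [h3, Real.div_rpow hGu.le hu.le]
    field_simp

section Profile

/-! A *profile* is a homeomorphism `k` with logarithmic derivative `q(r)/r`. The Young function `G`
with density `g(u) = 2 k⁻¹(2u)` inherits its behaviour at `0` from `q`. -/

variable {k q g κ : ℝ → ℝ}

lemma hasDerivAt_integral_comp_half (hgc : Continuous g)
    (hgk : ∀ r, 0 ≤ r → g (k r / 2) = 2 * r)
    (hd : ∀ r, 0 < r → HasDerivAt k (k r * q r / r) r) {r : ℝ} (hr : 0 < r) :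
    HasDerivAt (fun r => ∫ s in (0 : ℝ)..k r / 2, g s) (k r * q r) r := by
  refine ((hasDerivAt_integral_of_continuous hgc _).comp r ((hd r hr).div_const 2)).congr_deriv ?_
  rw [hgk r hr.le]
  field_simp

lemma tendsto_mul_div_integral (hk : IsIciHomeo k) (hg : IsIciHomeo g) (hgc : Continuous g)
    (hgk : ∀ r, 0 ≤ r → g (k r / 2) = 2 * r) (hkg : ∀ u, 0 ≤ u → k (g u / 2) = 2 * u)
    (hd : ∀ r, 0 < r → HasDerivAt k (k r * q r / r) r) (hq : ∀ r, 0 < r → 0 < q r)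
    (hq0 : Tendsto q (𝓝[>] 0) atTop) :
    Tendsto (fun t => t * g t / ∫ s in (0 : ℝ)..t, g s) (𝓝[>] 0) (𝓝 1) := by
  have hhalf : IsIciHomeo (fun x : ℝ => x / 2) := by
    simpa [div_eq_inv_mul] using IsIciHomeo.const_mul (c := 2⁻¹) (by norm_num)
  have hM := (isIciHomeo_integral hg hgc).comp (hhalf.comp hk)
  have hlim : Tendsto (fun r => r * k r / ∫ s in (0 : ℝ)..k r / 2, g s) (𝓝[>] 0) (𝓝 1) := by
    refine HasDerivAt.lhopital_zero_nhdsGT (f' := fun r => 1 * k r + r * (k r * q r / r))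
      (g' := fun r => k r * q r) ?_ ?_ ?_ ?_ ?_ ?_
    · filter_upwards [self_mem_nhdsWithin] with r hr
      exact (hasDerivAt_id r).mul (hd r hr)
    · filter_upwards [self_mem_nhdsWithin] with r hr
      exact hasDerivAt_integral_comp_half hgc hgk hd hr
    · filter_upwards [self_mem_nhdsWithin] with r hr
      exact (mul_pos (hk.pos hr) (hq r hr)).ne'
    · have h1 : Tendsto (fun r : ℝ => r) (𝓝[>] 0) (𝓝 0) := nhdsWithin_le_nhds
      simpa using h1.mul (hk.tendsto_nhdsGT.mono_right nhdsWithin_le_nhds)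
    · exact hM.tendsto_nhdsGT.mono_right nhdsWithin_le_nhds
    · have h1 : Tendsto (fun r => (q r)⁻¹ + 1) (𝓝[>] 0) (𝓝 1) := by
        simpa using hq0.inv_tendsto_atTop.add_const 1
      refine h1.congr' ?_
      filter_upwards [self_mem_nhdsWithin] with r hr
      have h2 := (hk.pos hr).ne'
      have h3 := (hq r hr).ne'
      have h4 : r ≠ 0 := ne_of_gt hr
      field_simp
  refine (hlim.comp (hhalf.comp hg).tendsto_nhdsGT).congr' ?_
  filter_upwards [self_mem_nhdsWithin] with t ht
  simp only [Function.comp_apply, hkg t (le_of_lt ht)]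
  rw [mul_div_cancel_left₀ t two_ne_zero]
  ring

lemma integrableOn_one_div_inverse (hk : IsIciHomeo k) (hg : IsIciHomeo g) (hgc : Continuous g)
    (hgk : ∀ r, 0 ≤ r → g (k r / 2) = 2 * r)
    (hd : ∀ r, 0 < r → HasDerivAt k (k r * q r / r) r) (hq : ∀ r, 0 < r → 0 < q r)
    (hqi : ∀ R, 0 < R → IntegrableOn q (Ioc 0 R)) {Ginv : ℝ → ℝ}
    (hinv : ∀ t, 0 ≤ t → Ginv (∫ s in (0 : ℝ)..t, g s) = t) :
    IntegrableOn (fun t => 1 / Ginv t) (Ioc 0 1) := by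
  have hhalf : IsIciHomeo (fun x : ℝ => x / 2) := by
    simpa [div_eq_inv_mul] using IsIciHomeo.const_mul (c := 2⁻¹) (by norm_num)
  have hM := (isIciHomeo_integral hg hgc).comp (hhalf.comp hk)
  obtain ⟨R, hR0, hR⟩ := hM.2.2.2.2 (mem_Ici.2 zero_le_one)
  have hRpos : 0 < R := by
    refine lt_of_le_of_ne hR0 fun h => ?_
    rw [← h, hM.1] at hR
    exact zero_ne_one hR
  have himg : (fun r => ∫ s in (0 : ℝ)..k r / 2, g s) '' Ioc 0 R = Ioc 0 1 := by
    ext y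
    constructor
    · rintro ⟨r, hr, rfl⟩
      exact ⟨hM.pos hr.1, (hM.mono hr.1.le hr.2).trans hR.le⟩
    · intro hy
      obtain ⟨r, hr, rfl⟩ := hM.2.2.2.2 (mem_Ici.2 hy.1.le)
      refine ⟨r, ⟨lt_of_le_of_ne hr fun h => ?_,
        (hM.2.2.1.le_iff_le hr hR0).1 (hy.2.trans hR.ge)⟩, rfl⟩
      rw [← h, hM.1] at hy
      exact hy.1.ne rfl
  rw [← himg, integrableOn_image_iff_integrableOn_abs_deriv_smul measurableSet_Ioc
    (fun r hr => (hasDerivAt_integral_comp_half hgc hgk hd hr.1).hasDerivWithinAt)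
    (hM.2.2.1.injOn.mono fun r hr => hr.1.le)]
  refine IntegrableOn.congr_fun ((hqi R hRpos).const_mul 2) (fun r hr => ?_) measurableSet_Ioc
  have hkr := hk.pos hr.1
  rw [hinv _ (half_pos hkr).le, abs_of_pos (mul_pos hkr (hq r hr.1)), smul_eq_mul]
  field_simp

end Profile

/-- Every profile `k` whose logarithmic derivative `q(r)/r` is such that `q → ∞` at `0` and `q` is
integrable near `0` gives a complementary pair with `F(t) ≤ t^p k(t)^p`. -/
theorem exists_young_pair_of_profile {p : ℝ} (hp : 1 < p) {k q : ℝ → ℝ} (hk : IsIciHomeo k)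
    (hd : ∀ r, 0 < r → HasDerivAt k (k r * q r / r) r) (hq : ∀ r, 0 < r → 0 < q r)
    (hq0 : Tendsto q (𝓝[>] 0) atTop) (hqi : ∀ R, 0 < R → IntegrableOn q (Ioc 0 R)) :
    ∃ G F : ℝ → ℝ,
      (∃ g : ℝ → ℝ, IsIciHomeo g ∧ ∀ t, 0 ≤ t → G t = ∫ s in (0:ℝ)..t, g s) ∧
      IsIciHomeo G ∧
      (∃ G' : ℝ → ℝ, ContinuousOn G' (Set.Ioi 0) ∧
        (∀ t : ℝ, 0 < t → HasDerivAt G (G' t) t ∧ 0 < G' t) ∧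
        Filter.Tendsto (fun t : ℝ => t * G' t / G t) (nhdsWithin 0 (Set.Ioi 0)) (nhds 1)) ∧
      (∃ Ginv : ℝ → ℝ, (∀ t, 0 ≤ t → Ginv (G t) = t ∧ G (Ginv t) = t ∧ 0 ≤ Ginv t) ∧
        MeasureTheory.IntegrableOn (fun t : ℝ => 1 / Ginv t) (Set.Ioc 0 1)) ∧
      (∃ φ ψ : ℝ → ℝ, IsIciHomeo φ ∧
        (∀ s, 0 ≤ s → ψ (φ s) = s) ∧ (∀ t, 0 ≤ t → φ (ψ t) = t ∧ 0 ≤ ψ t) ∧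
        (∀ t : ℝ, 0 ≤ t → G (t ^ (1 / p)) ^ p = ∫ s in (0:ℝ)..t, φ s) ∧
        (∀ t : ℝ, 0 ≤ t → F (t ^ (1 / p)) = ∫ s in (0:ℝ)..t, ψ s)) ∧
      (∀ t : ℝ, 0 ≤ t → 0 ≤ F t) ∧
      (∀ t : ℝ, 0 < t → F t ≤ t ^ p * k t ^ p) := by
  have hp0 : 0 < p := by linarith
  obtain ⟨κ, hκ, hκc, hκk⟩ := hk.exists_inverse
  have hg : IsIciHomeo (fun u => 2 * κ (2 * u)) :=
    (IsIciHomeo.const_mul two_pos).comp (hκ.comp (.const_mul two_pos))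
  have hgc : Continuous (fun u => 2 * κ (2 * u)) := by fun_prop
  set g : ℝ → ℝ := fun u => 2 * κ (2 * u) with hg_def
  have hgk : ∀ r, 0 ≤ r → g (k r / 2) = 2 * r := fun r hr => by
    simp only [hg_def]
    rw [mul_div_cancel₀ _ two_ne_zero, (hκk r hr).1]
  have hkg : ∀ u, 0 ≤ u → k (g u / 2) = 2 * u := fun u hu => by
    simp only [hg_def]
    rw [mul_div_cancel_left₀ _ two_ne_zero, (hκk (2 * u) (by linarith)).2]
  have hG := isIciHomeo_integral hg hgc
  obtain ⟨Ginv, hGinv, -, hGG⟩ := hG.exists_inverse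
  have hH := isIciHomeo_powDensity hp hg hgc
  have hφ := hH.comp (.rpow (q := 1 / p) (by positivity))
  obtain ⟨ψ, hψ, hψc, hψφ⟩ := hφ.exists_inverse
  refine ⟨fun t => ∫ s in (0 : ℝ)..t, g s, fun t => ∫ s in (0 : ℝ)..t ^ p, ψ s,
    ⟨g, hg, fun _ _ => rfl⟩, hG, ⟨g, hgc.continuousOn, fun t ht =>
      ⟨hasDerivAt_integral_of_continuous hgc t, hg.pos ht⟩,
      tendsto_mul_div_integral hk hg hgc hgk hkg hd hq hq0⟩,
    ⟨Ginv, fun t ht => ⟨(hGG t ht).1, (hGG t ht).2, hGinv.nonneg ht⟩,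
      integrableOn_one_div_inverse hk hg hgc hgk hd hq hqi fun t ht => (hGG t ht).1⟩,
    ⟨_, ψ, hφ, fun s hs => (hψφ s hs).1, fun t ht => ⟨(hψφ t ht).2, hψ.nonneg ht⟩,
      fun t ht => rpow_integral_eq_integral_powDensity hp hg hgc ht, fun t ht => ?_⟩,
    fun t ht => ?_, fun t ht => ?_⟩
  · simp only
    rw [← Real.rpow_mul ht, one_div_mul_cancel hp0.ne', Real.rpow_one]
  · exact (isIciHomeo_integral hψ hψc).nonneg (Real.rpow_nonneg ht _)
  · have htp : 0 < t ^ p := Real.rpow_pos_of_pos ht _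
    have h1 := integral_le_mul_sub hψ hψc le_rfl htp.le
    rw [sub_zero] at h1
    refine h1.trans (mul_le_mul_of_nonneg_left ?_ htp.le)
    have hs := hψ.pos htp
    set s := ψ (t ^ p)
    have hu : 0 < s ^ (1 / p) := Real.rpow_pos_of_pos hs _
    have h2 := rpow_le_powDensity hp hg hgc hu
    rw [(hψφ _ htp.le).2] at h2
    have h3 : κ (s ^ (1 / p)) ≤ t := by
      have h4 := (Real.rpow_le_rpow_iff (half_pos (hg.pos (half_pos hu))).le ht.le hp0).1 h2
      simp only [hg_def] at h4
      rwa [mul_div_cancel₀ _ two_ne_zero, mul_div_cancel_left₀ _ two_ne_zero] at h4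
    have h5 : s ^ (1 / p) ≤ k t := by
      have := hk.mono (hκ.nonneg hu.le) h3
      rwa [(hκk _ hu.le).2] at this
    have h6 := Real.rpow_le_rpow hu.le h5 hp0.le
    rwa [← Real.rpow_mul hs.le, one_div_mul_cancel hp0.ne', Real.rpow_one] at h6

section Decay

/-- `x = 1/t` times a negative power of its logarithm: the rate in the exponential decay. -/
noncomputable def decayRate (ε t : ℝ) : ℝ :=
  1 / t * Real.log (Real.exp 1 + 1 / t) ^ (-(1 + ε))

/-- The function `-t E'(t)`, where `E` is `decayRate`. -/
noncomputable def decaySlope (ε t : ℝ) : ℝ :=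
  decayRate ε t * (1 - (1 + ε) * (1 / t) / ((Real.exp 1 + 1 / t) * Real.log (Real.exp 1 + 1 / t)))

variable {ε : ℝ}

lemma one_lt_log_exp_one_add {x : ℝ} (hx : 0 < x) : 1 < Real.log (Real.exp 1 + x) := by
  rw [Real.lt_log_iff_exp_lt (by positivity)]
  linarith

lemma decayRate_pos {t : ℝ} (ht : 0 < t) : 0 < decayRate ε t := by
  have h := one_lt_log_exp_one_add (one_div_pos.2 ht)
  exact mul_pos (one_div_pos.2 ht) (Real.rpow_pos_of_pos (by linarith) _)

lemma mul_lt_mul_log_exp_one_add (hε1 : ε < 1) {x : ℝ} (hx : 0 < x) :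
    (1 + ε) * x < (Real.exp 1 + x) * Real.log (Real.exp 1 + x) := by
  have he := Real.exp_pos 1
  have hy : 0 < Real.exp 1 + x := by positivity
  have h1 := Real.one_sub_inv_le_log_of_pos (div_pos hy he)
  rw [Real.log_div hy.ne' he.ne', Real.log_exp, inv_div] at h1
  have h2 : (Real.exp 1 + x) * (2 - Real.exp 1 / (Real.exp 1 + x))
      ≤ (Real.exp 1 + x) * Real.log (Real.exp 1 + x) :=
    mul_le_mul_of_nonneg_left (by linarith) hy.le
  have h3 : (Real.exp 1 + x) * (2 - Real.exp 1 / (Real.exp 1 + x)) = Real.exp 1 + 2 * x := by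
    field_simp
    ring
  nlinarith

lemma decaySlope_nonneg (hε1 : ε < 1) {t : ℝ} (ht : 0 < t) : 0 ≤ decaySlope ε t := by
  have hx := one_div_pos.2 ht
  have h := one_lt_log_exp_one_add hx
  refine mul_nonneg (decayRate_pos ht).le (sub_nonneg.2 ((div_le_one ?_).2 ?_))
  · have := Real.exp_pos 1
    exact mul_pos (by positivity) (by linarith)
  · exact (mul_lt_mul_log_exp_one_add hε1 hx).le

lemma decaySlope_le_decayRate (hε : 0 < ε) {t : ℝ} (ht : 0 < t) :
    decaySlope ε t ≤ decayRate ε t := by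
  have hx := one_div_pos.2 ht
  have h := one_lt_log_exp_one_add hx
  refine mul_le_of_le_one_right (decayRate_pos ht).le (sub_le_self _ ?_)
  have := Real.exp_pos 1
  exact div_nonneg (by positivity) (mul_nonneg (by positivity) (by linarith))

lemma hasDerivAt_log_exp_one_add {t : ℝ} (ht : 0 < t) :
    HasDerivAt (fun t => Real.log (Real.exp 1 + 1 / t))
      (-(1 / t ^ 2) / (Real.exp 1 + 1 / t)) t := by
  have h1 : HasDerivAt (fun t : ℝ => Real.exp 1 + 1 / t) (-(1 / t ^ 2)) t := by
    simpa [one_div] using (hasDerivAt_inv ht.ne').const_add (Real.exp 1)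
  exact h1.log (by positivity)

lemma hasDerivAt_log_rpow (c : ℝ) {t : ℝ} (ht : 0 < t) :
    HasDerivAt (fun t => Real.log (Real.exp 1 + 1 / t) ^ c)
      (-(1 / t ^ 2) / (Real.exp 1 + 1 / t) * c * Real.log (Real.exp 1 + 1 / t) ^ (c - 1)) t := by
  have h := one_lt_log_exp_one_add (one_div_pos.2 ht)
  exact (hasDerivAt_log_exp_one_add ht).rpow_const (.inl (by linarith))

lemma hasDerivAt_decayRate {t : ℝ} (ht : 0 < t) :
    HasDerivAt (decayRate ε) (-(decaySlope ε t / t)) t := by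
  have h := one_lt_log_exp_one_add (one_div_pos.2 ht)
  have h1 : HasDerivAt (fun t : ℝ => 1 / t) (-(1 / t ^ 2)) t := by
    simpa [one_div] using hasDerivAt_inv ht.ne'
  refine (h1.mul (hasDerivAt_log_rpow (-(1 + ε)) ht)).congr_deriv ?_
  have hl : Real.log (Real.exp 1 + 1 / t) ≠ 0 := by linarith
  have hy : Real.exp 1 + 1 / t ≠ 0 := by positivity
  rw [Real.rpow_sub_one hl, decaySlope, decayRate]
  generalize Real.log (Real.exp 1 + 1 / t) ^ (-(1 + ε)) = A
  generalize Real.log (Real.exp 1 + 1 / t) = l at *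
  generalize Real.exp 1 + 1 / t = y at *
  field_simp
  ring

lemma tendsto_one_div_nhdsGT : Tendsto (fun t : ℝ => 1 / t) (𝓝[>] 0) atTop := by
  simpa [one_div] using tendsto_inv_nhdsGT_zero (𝕜 := ℝ)

lemma tendsto_log_exp_one_add :
    Tendsto (fun t : ℝ => Real.log (Real.exp 1 + 1 / t)) (𝓝[>] 0) atTop :=
  Real.tendsto_log_atTop.comp (tendsto_atTop_add_const_left _ _ tendsto_one_div_nhdsGT)

lemma tendsto_decaySlope (hε1 : ε < 1) :
    Tendsto (decaySlope ε) (𝓝[>] 0) atTop := by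
  have h1 := ((tendsto_exp_div_rpow_atTop (1 + ε)).comp
    tendsto_log_exp_one_add).atTop_div_const (r := 4) (by norm_num)
  refine tendsto_atTop_mono' _ ?_ h1
  filter_upwards [self_mem_nhdsWithin, tendsto_log_exp_one_add.eventually_ge_atTop 4,
    tendsto_one_div_nhdsGT.eventually_ge_atTop (Real.exp 1)] with t ht hl hx
  have he := Real.exp_pos 1
  have hx0 : 0 < 1 / t := he.trans_le hx
  have hy : 0 < Real.exp 1 + 1 / t := by positivity
  simp only [Function.comp_apply]
  rw [Real.exp_log hy, decaySlope, decayRate, Real.rpow_neg (by linarith)]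
  have hA : 0 < Real.log (Real.exp 1 + 1 / t) ^ (1 + ε) := Real.rpow_pos_of_pos (by linarith) _
  have h2 : (1 + ε) * (1 / t) / ((Real.exp 1 + 1 / t) * Real.log (Real.exp 1 + 1 / t)) ≤ 1 / 2 := by
    rw [div_le_iff₀ (mul_pos hy (by linarith))]
    nlinarith
  generalize Real.log (Real.exp 1 + 1 / t) ^ (1 + ε) = A at *
  calc (Real.exp 1 + 1 / t) / A / 4 ≤ (2 * (1 / t)) / A / 4 := by gcongr; linarith
    _ = 1 / t * A⁻¹ * (1 / 2) := by ring
    _ ≤ _ := mul_le_mul_of_nonneg_left (by linarith) (by positivity)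

lemma integrableOn_decaySlope (hε : 0 < ε) (hε1 : ε < 1) {R : ℝ} :
    IntegrableOn (decaySlope ε) (Ioc 0 R) := by
  let D : ℝ → ℝ := fun t => -(1 / t ^ 2) / (Real.exp 1 + 1 / t) * (-ε) *
    Real.log (Real.exp 1 + 1 / t) ^ (-ε - 1)
  let m : ℝ → ℝ := Function.update (fun t => Real.log (Real.exp 1 + 1 / t) ^ (-ε)) 0 0
  have hm : ∀ t, 0 < t → HasDerivAt m (D t) t := fun t ht =>
    (hasDerivAt_log_rpow (-ε) ht).congr_of_eventuallyEq <| by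
      filter_upwards [eventually_ne_nhds ht.ne'] with s hs
      simp [m, hs]
  have hDE : ∀ t, 0 < t → decayRate ε t = (Real.exp 1 * t + 1) / ε * D t := fun t ht => by
    have hy : Real.exp 1 * t + 1 ≠ 0 := by positivity
    simp only [D, decayRate, show -ε - 1 = -(1 + ε) by ring]
    generalize Real.log (Real.exp 1 + 1 / t) ^ (-(1 + ε)) = A
    field_simp
  have hD0 : ∀ t, 0 < t → 0 ≤ D t := fun t ht => by
    have h1 := decayRate_pos (ε := ε) ht
    rw [hDE t ht] at h1
    exact (pos_of_mul_pos_right h1 (by positivity)).le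
  have hmc : ContinuousOn m (Icc 0 R) := fun t ht => by
    rcases ht.1.eq_or_lt with rfl | h
    · refine ContinuousWithinAt.mono (t := Ici 0) ?_ Icc_subset_Ici_self
      rw [← continuousWithinAt_Ioi_iff_Ici, ContinuousWithinAt, show m 0 = 0 by simp [m]]
      refine ((tendsto_rpow_neg_atTop hε).comp tendsto_log_exp_one_add).congr' ?_
      filter_upwards [self_mem_nhdsWithin] with s hs
      simp [m, (mem_Ioi.1 hs).ne']
    · exact (hm t h).continuousAt.continuousWithinAt
  have hDi : IntegrableOn D (Ioc 0 R) :=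
    intervalIntegral.integrableOn_deriv_of_nonneg hmc (fun t ht => hm t ht.1)
      (fun t ht => hD0 t ht.1)
  refine Integrable.mono' (hDi.const_mul ((Real.exp 1 * R + 1) / ε)) ?_ ?_
  · have : Measurable (decaySlope ε) := by
      unfold decaySlope decayRate
      fun_prop
    exact this.aestronglyMeasurable
  · refine (ae_restrict_mem measurableSet_Ioc).mono fun t ht => ?_
    rw [Real.norm_of_nonneg (decaySlope_nonneg hε1 ht.1)]
    refine (decaySlope_le_decayRate hε ht.1).trans ?_
    rw [hDE t ht.1]
    have := hD0 t ht.1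
    have := ht.2
    gcongr

end Decay

lemma antitoneOn_decayRate {ε : ℝ} (hε1 : ε < 1) : AntitoneOn (decayRate ε) (Ioi 0) := by
  refine antitoneOn_of_deriv_nonpos (convex_Ioi 0)
    (fun t ht => (hasDerivAt_decayRate ht).continuousAt.continuousWithinAt)
    (fun t ht => ?_) (fun t ht => ?_) <;> rw [interior_Ioi] at ht
  · exact (hasDerivAt_decayRate ht).differentiableAt.differentiableWithinAt
  · rw [(hasDerivAt_decayRate ht).deriv, neg_nonpos]
    exact div_nonneg (decaySlope_nonneg hε1 ht) (le_of_lt ht)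

lemma hasDerivAt_rpow_mul_exp_decayRate {p ε : ℝ} {r : ℝ} (hr : 0 < r) :
    HasDerivAt (fun r => r ^ (ε / p) * Real.exp (-decayRate ε r / p))
      (r ^ (ε / p) * Real.exp (-decayRate ε r / p) * ((ε + decaySlope ε r) / p) / r) r := by
  have h1 : HasDerivAt (fun r : ℝ => r ^ (ε / p)) (ε / p * r ^ (ε / p - 1)) r :=
    Real.hasDerivAt_rpow_const (.inl hr.ne')
  refine (h1.mul ((hasDerivAt_decayRate (ε := ε) hr).neg.div_const p).exp).congr_deriv ?_
  rw [Real.rpow_sub_one hr.ne']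
  simp only [Pi.neg_apply]
  ring

lemma isIciHomeo_rpow_mul_exp_decayRate {p ε : ℝ} (hp : 0 < p) (hε : 0 < ε) (hε1 : ε < 1) :
    IsIciHomeo (fun r => r ^ (ε / p) * Real.exp (-decayRate ε r / p)) := by
  have hq : 0 < ε / p := div_pos hε hp
  have h0 : (0 : ℝ) ^ (ε / p) * Real.exp (-decayRate ε 0 / p) = 0 := by
    rw [Real.zero_rpow hq.ne', zero_mul]
  have hc : ContinuousOn (fun r => r ^ (ε / p) * Real.exp (-decayRate ε r / p)) (Ici 0) := by
    intro r hr
    rcases (mem_Ici.1 hr).eq_or_lt with rfl | hr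
    · have hb : Tendsto (fun r : ℝ => r ^ (ε / p)) (𝓝[Ici 0] 0) (𝓝 0) := by
        simpa [Real.zero_rpow hq.ne'] using
          ((Real.continuous_rpow_const hq.le).continuousWithinAt (s := Ici 0) (x := 0)).tendsto
      rw [ContinuousWithinAt, h0]
      refine squeeze_zero' ?_ ?_ hb
      · filter_upwards [self_mem_nhdsWithin] with r hr
        exact mul_nonneg (Real.rpow_nonneg hr _) (Real.exp_pos _).le
      · filter_upwards [self_mem_nhdsWithin] with r hr
        refine mul_le_of_le_one_right (Real.rpow_nonneg hr _) (Real.exp_le_one_iff.2 ?_)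
        rcases (mem_Ici.1 hr).eq_or_lt with rfl | hr
        · simp [decayRate]
        · exact div_nonpos_of_nonpos_of_nonneg (neg_nonpos.2 (decayRate_pos hr).le) hp.le
    · exact (hasDerivAt_rpow_mul_exp_decayRate hr).continuousAt.continuousWithinAt
  refine .of_tendsto h0 hc ?_ ?_
  · refine strictMonoOn_of_deriv_pos (convex_Ici 0) hc fun r hr => ?_
    rw [interior_Ici, mem_Ioi] at hr
    have := decaySlope_nonneg hε1 hr
    rw [(hasDerivAt_rpow_mul_exp_decayRate hr).deriv]
    positivity
  · refine tendsto_atTop_mono' _ ?_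
      ((tendsto_rpow_atTop hq).atTop_mul_const (Real.exp_pos (-decayRate ε 1 / p)))
    filter_upwards [eventually_ge_atTop 1] with r hr
    have hr0 : 0 < r := by linarith
    have := antitoneOn_decayRate hε1 (mem_Ioi.2 one_pos) (mem_Ioi.2 hr0) hr
    gcongr

/-- existence of `F ∈ 𝓕_p` with the decay \eqref{fexists}.
For `p > 1` and `ε₀ ∈ (0,1)` there are `G, F : [0,∞) → [0,∞)` such that
(i) `G` is a Young function; (ii) `G` is a homeomorphism of `[0,∞)` and a diffeomorphism
on `(0,∞)`; (iii) `∫₀¹ dt/G⁻¹(t) < ∞`; (iv) `t G'(t)/G(t) → 1` as `t → 0⁺`;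
(v) `G((·)^{1/p})^p` and `F((·)^{1/p})` form a complementary Young pair; and
(vi) `F(t) ≤ t^{p+ε₀} exp(−(1/t)(log(e + 1/t))^{−1−ε₀})`. -/
theorem exists_young_pair_with_decay (p ε₀ : ℝ) (hp : 1 < p) (hε₀ : 0 < ε₀) (hε₀1 : ε₀ < 1) :
    ∃ G F : ℝ → ℝ,
      -- (i) G is a Young function
      (∃ g : ℝ → ℝ, IsIciHomeo g ∧ ∀ t, 0 ≤ t → G t = ∫ s in (0:ℝ)..t, g s) ∧
      -- (ii) G is a homeomorphism of [0,∞) and a diffeomorphism on (0,∞)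
      IsIciHomeo G ∧
      (∃ G' : ℝ → ℝ, ContinuousOn G' (Set.Ioi 0) ∧
        (∀ t : ℝ, 0 < t → HasDerivAt G (G' t) t ∧ 0 < G' t) ∧
        -- (iv) lim_{t→0⁺} t G'(t)/G(t) = 1
        Filter.Tendsto (fun t : ℝ => t * G' t / G t) (nhdsWithin 0 (Set.Ioi 0)) (nhds 1)) ∧
      -- (iii) ∫₀¹ dt/G⁻¹(t) < ∞
      (∃ Ginv : ℝ → ℝ, (∀ t, 0 ≤ t → Ginv (G t) = t ∧ G (Ginv t) = t ∧ 0 ≤ Ginv t) ∧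
        MeasureTheory.IntegrableOn (fun t : ℝ => 1 / Ginv t) (Set.Ioc 0 1)) ∧
      -- (v) G((·)^{1/p})^p and F((·)^{1/p}) form a complementary Young pair
      (∃ φ ψ : ℝ → ℝ, IsIciHomeo φ ∧
        (∀ s, 0 ≤ s → ψ (φ s) = s) ∧ (∀ t, 0 ≤ t → φ (ψ t) = t ∧ 0 ≤ ψ t) ∧
        (∀ t : ℝ, 0 ≤ t → G (t ^ (1 / p)) ^ p = ∫ s in (0:ℝ)..t, φ s) ∧
        (∀ t : ℝ, 0 ≤ t → F (t ^ (1 / p)) = ∫ s in (0:ℝ)..t, ψ s)) ∧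
      -- (vi) decay estimate for F
      (∀ t : ℝ, 0 ≤ t → 0 ≤ F t) ∧
      (∀ t : ℝ, 0 < t →
        F t ≤ t ^ (p + ε₀) *
          Real.exp (-(1 / t) * Real.log (Real.exp 1 + 1 / t) ^ (-(1 + ε₀)))) := by
  obtain ⟨G, F, h1, h2, h3, h4, h5, h6, h7⟩ := exists_young_pair_of_profile hp
    (isIciHomeo_rpow_mul_exp_decayRate (by linarith) hε₀ hε₀1)
    (q := fun r => (ε₀ + decaySlope ε₀ r) / p)
    (fun r hr => hasDerivAt_rpow_mul_exp_decayRate hr)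
    (fun r hr => div_pos (by linarith [decaySlope_nonneg hε₀1 hr]) (by linarith))
    ((tendsto_atTop_add_const_left _ _ (tendsto_decaySlope hε₀1)).atTop_div_const (by linarith))
    (fun R _ => ((integrableOn_const (by simp)).add
      (integrableOn_decaySlope hε₀ hε₀1)).div_const p)
  refine ⟨G, F, h1, h2, h3, h4, h5, h6, fun t ht => (h7 t ht).trans_eq ?_⟩
  have hp0 : p ≠ 0 := by linarith
  rw [Real.mul_rpow (Real.rpow_nonneg ht.le _) (Real.exp_pos _).le, ← Real.rpow_mul ht.le,
    ← Real.exp_mul, div_mul_cancel₀ _ hp0, div_mul_cancel₀ _ hp0, ← mul_assoc,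
    ← Real.rpow_add ht, decayRate, neg_mul]
end
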